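/- Let w = (w_1, w_2, …) be a non-increasing sequence of nonnegative reals with w_1 = 1 such that w_j < 1 for some index j (i.e., the sequential w-Thiele rule is not approval voting), and fix a linear tie-breaking order on parties. Then there exist a committee size k, a number of parties m, and a number of voters n such that the sequential w-Thiele rule fails strategyproofness for unrepresented voters, i.e., there exist profiles A, A' and a voter i with A_j = A'_j for all j ≠ i, f(A, A_i) = 0, and f(A', A_i) > 0, where f denotes the sequential w-Thiele rule. -/

import Mathlib

/-- An approval profile is valid if every voter's ballot is nonempty. -/
def ValidProfile {P : Type*} (n : ℕ) (A : Fin n → Finset P) : Prop :=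
  ∀ i, (A i).Nonempty

/-- The number of seats a committee `W` assigns to the parties in `X`. -/
def seats {P : Type*} [DecidableEq P] (W : Multiset P) (X : Finset P) : ℕ :=
  ∑ x ∈ X, W.count x

/-- The `w`-Thiele score of a committee `W` in the profile `A`:
`∑ i, (w 0 + w 1 + ⋯ + w (W(A_i) - 1))` (weights indexed from `0`, so `w 0` is the
paper's `w_1`). -/
noncomputable def thieleScore {P : Type*} [DecidableEq P] (w : ℕ → ℝ) {n : ℕ}
    (A : Fin n → Finset P) (W : Multiset P) : ℝ :=
  ∑ i : Fin n, ∑ j ∈ Finset.range (seats W (A i)), w j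

/-- `f` is the `w`-Thiele rule for `n` voters and committee size `k`, with ties among
score-maximal committees broken by the (strict, linear) order `tb k`: for every valid
profile, `f A` is a committee of size `k` with maximal `w`-Thiele score that
`tb k`-beats every other score-maximal committee of size `k`. -/
def IsThieleRule {P : Type*} [DecidableEq P] (w : ℕ → ℝ)
    (tb : ℕ → Multiset P → Multiset P → Prop) (n k : ℕ)
    (f : (Fin n → Finset P) → Multiset P) : Prop :=
  ∀ A, ValidProfile n A →
    Multiset.card (f A) = k ∧
    (∀ W : Multiset P, Multiset.card W = k → thieleScore w A W ≤ thieleScore w A (f A)) ∧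
    (∀ W : Multiset P, Multiset.card W = k → W ≠ f A →
      thieleScore w A W = thieleScore w A (f A) → tb k (f A) W)

/-- Weak representation: a party uniquely approved by at least `n / k` voters
gets at least one seat. -/
def WeakRep {P : Type*} [DecidableEq P] (n k : ℕ)
    (f : (Fin n → Finset P) → Multiset P) : Prop :=
  ∀ A, ValidProfile n A → ∀ (x : P) (G : Finset (Fin n)),
    n ≤ k * G.card → (∀ i ∈ G, A i = {x}) → 1 ≤ (f A).count x

/-- Strategyproofness for unrepresented voters: a voter who approves no party of
the elected committee cannot obtain a represented party by misreporting. -/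
def SPUnrepresented {P : Type*} [DecidableEq P] (n : ℕ)
    (f : (Fin n → Finset P) → Multiset P) : Prop :=
  ∀ A A' : Fin n → Finset P, ValidProfile n A → ValidProfile n A' →
    ∀ i : Fin n, (∀ j, j ≠ i → A j = A' j) → seats (f A) (A i) = 0 →
      seats (f A') (A i) ≤ seats (f A) (A i)

/-- `f` is the sequential `w`-Thiele rule for `n` voters and committee size `k`, with
ties broken by the (strict, linear) order `tbp` on parties: for every valid profile,
`f A` is obtained by `k` greedy rounds, each adding the party whose addition increases
the `w`-Thiele score the most (tie-breaking by `tbp`). -/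
def IsSeqThieleRule {P : Type*} [DecidableEq P] (w : ℕ → ℝ)
    (tbp : P → P → Prop) (n k : ℕ)
    (f : (Fin n → Finset P) → Multiset P) : Prop :=
  ∀ A, ValidProfile n A →
    ∃ c : ℕ → Multiset P, c 0 = 0 ∧ f A = c k ∧
      ∀ t < k, ∃ x : P,
        c (t + 1) = x ::ₘ c t ∧
        (∀ y : P, thieleScore w A (y ::ₘ c t) ≤ thieleScore w A (x ::ₘ c t)) ∧
        (∀ y : P, y ≠ x →
          thieleScore w A (y ::ₘ c t) = thieleScore w A (x ::ₘ c t) → tbp x y)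

/-- The additional satisfaction that a voter with ballot `S` draws from adding `y` to `W`. -/
def marginalGain {P : Type*} [DecidableEq P] (w : ℕ → ℝ) (W : Multiset P) (y : P)
    (S : Finset P) : ℝ :=
  if y ∈ S then w (seats W S) else 0

theorem seats_cons {P : Type*} [DecidableEq P] (W : Multiset P) (y : P) (S : Finset P) :
    seats (y ::ₘ W) S = seats W S + if y ∈ S then 1 else 0 := by
  simp [seats, Multiset.count_cons, Finset.sum_add_distrib]

theorem seats_replicate {P : Type*} [DecidableEq P] (t : ℕ) (b : P) (S : Finset P) :
    seats (Multiset.replicate t b) S = if b ∈ S then t else 0 := by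
  simp [seats, Multiset.count_replicate]

theorem thieleScore_cons {P : Type*} [DecidableEq P] (w : ℕ → ℝ) {n : ℕ}
    (A : Fin n → Finset P) (W : Multiset P) (y : P) :
    thieleScore w A (y ::ₘ W) = thieleScore w A W + ∑ i, marginalGain w W y (A i) := by
  unfold thieleScore marginalGain
  rw [← Finset.sum_add_distrib]
  refine Finset.sum_congr rfl fun i _ => ?_
  rw [seats_cons]
  split_ifs <;> simp [Finset.sum_range_succ]

/-- Among finitely many alternatives there is a maximizer of `s` that is preferred by `r` to
every other maximizer. -/
theorem exists_maximizer_tiebreak {P : Type*} [Finite P] [Nonempty P] (r : P → P → Prop)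
    [IsStrictTotalOrder P r] (s : P → ℝ) :
    ∃ x, (∀ y, s y ≤ s x) ∧ ∀ y, y ≠ x → s y = s x → r x y := by
  obtain ⟨x₀, hx₀⟩ := Finite.exists_max s
  have hwf : WellFounded r := Finite.wellFounded_of_trans_of_irrefl r
  obtain ⟨x, hx, hmin⟩ := hwf.has_min {x | s x = s x₀} ⟨x₀, rfl⟩
  refine ⟨x, fun y => hx.symm ▸ hx₀ y, fun y hyx hy => ?_⟩
  rcases trichotomous_of r x y with h | h | h
  · exact h
  · exact absurd h.symm hyx
  · exact absurd h (hmin y (hy.trans hx))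

theorem exists_isSeqThieleRule {P : Type*} [DecidableEq P] [Finite P] [Nonempty P]
    (w : ℕ → ℝ) (tbp : P → P → Prop) [IsStrictTotalOrder P tbp] (n k : ℕ) :
    ∃ f : (Fin n → Finset P) → Multiset P, IsSeqThieleRule w tbp n k f := by
  choose g hg using fun (A : Fin n → Finset P) (W : Multiset P) =>
    exists_maximizer_tiebreak tbp fun y => thieleScore w A (y ::ₘ W)
  exact ⟨fun A => Nat.rec 0 (fun _ W => g A W ::ₘ W) k, fun A _ =>
    ⟨fun t => Nat.rec 0 (fun _ W => g A W ::ₘ W) t, rfl, rfl, fun t _ => ⟨_, rfl, hg A _⟩⟩⟩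

/-- If `b` wins each of the first `j` rounds and `d` wins round `j + 1`, then the sequential
`w`-Thiele rule elects `d` once and `b` in the remaining `j` seats. -/
theorem IsSeqThieleRule.eq_cons_replicate {P : Type*} [DecidableEq P] {w : ℕ → ℝ}
    {tbp : P → P → Prop} [IsStrictTotalOrder P tbp] {n j : ℕ}
    {f : (Fin n → Finset P) → Multiset P} (hf : IsSeqThieleRule w tbp n (j + 1) f)
    {A : Fin n → Finset P} (hA : ValidProfile n A) (b d : P)
    (hb : ∀ t < j, ∀ y, y ≠ b →
      ∑ i, marginalGain w (Multiset.replicate t b) y (A i) <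
          ∑ i, marginalGain w (Multiset.replicate t b) b (A i) ∨
        (∑ i, marginalGain w (Multiset.replicate t b) y (A i) =
          ∑ i, marginalGain w (Multiset.replicate t b) b (A i) ∧ tbp b y))
    (hd : ∀ y, y ≠ d →
      ∑ i, marginalGain w (Multiset.replicate j b) y (A i) <
        ∑ i, marginalGain w (Multiset.replicate j b) d (A i)) :
    f A = d ::ₘ Multiset.replicate j b := by
  obtain ⟨c, hc0, hfc, hc⟩ := hf A hA
  have step : ∀ t < j + 1, ∀ z, (∀ y, y ≠ z →
      ∑ i, marginalGain w (c t) y (A i) < ∑ i, marginalGain w (c t) z (A i) ∨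
        (∑ i, marginalGain w (c t) y (A i) = ∑ i, marginalGain w (c t) z (A i) ∧ tbp z y)) →
      c (t + 1) = z ::ₘ c t := by
    intro t ht z hz
    obtain ⟨x, hx, hmax, htie⟩ := hc t ht
    rcases eq_or_ne x z with rfl | hxz
    · exact hx
    · have hmax := hmax z
      have htie := htie z hxz.symm
      simp only [thieleScore_cons] at hmax htie
      rcases hz x hxz with h | ⟨h, h'⟩
      · linarith
      · exact absurd h' (asymm_of tbp (htie (by rw [h])))
  have hrep : ∀ t ≤ j, c t = Multiset.replicate t b := by
    intro t
    induction t with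
    | zero => intro _; simpa using hc0
    | succ t ih =>
      intro ht
      have ih := ih (by lia)
      rw [step t (by lia) b (by rw [ih]; exact hb t (by lia)), ih, Multiset.replicate_succ]
  rw [hfc, step j (by lia) d (by rw [hrep j le_rfl]; exact fun y hy => Or.inl (hd y hy)),
    hrep j le_rfl]

/-- The profile with `z + 2` ballots each of `{a, b}`, `{b, p}` and `{a}`, `z` ballots `{p}`,
and one last ballot `X`. -/
def overlapProfile {P : Type*} [DecidableEq P] (a b p : P) (z : ℕ) (X : Finset P) :
    Fin ((z + 2) + (z + 2) + (z + 2) + z + 1) → Finset P :=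
  Fin.snoc (α := fun _ => Finset P)
    (Fin.append (Fin.append (Fin.append (fun _ : Fin (z + 2) => {a, b})
      (fun _ : Fin (z + 2) => {b, p})) (fun _ : Fin (z + 2) => {a})) (fun _ : Fin z => {p})) X

theorem overlapProfile_last {P : Type*} [DecidableEq P] (a b p : P) (z : ℕ) (X : Finset P) :
    overlapProfile a b p z X (Fin.last _) = X := by
  simp [overlapProfile]

theorem overlapProfile_eq_of_ne_last {P : Type*} [DecidableEq P] (a b p : P) (z : ℕ)
    (X Y : Finset P) (i : Fin ((z + 2) + (z + 2) + (z + 2) + z + 1)) (hi : i ≠ Fin.last _) :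
    overlapProfile a b p z X i = overlapProfile a b p z Y i := by
  induction i using Fin.lastCases with
  | last => exact absurd rfl hi
  | cast i => simp [overlapProfile]

theorem validProfile_overlapProfile {P : Type*} [DecidableEq P] (a b p : P) (z : ℕ)
    {X : Finset P} (hX : X.Nonempty) : ValidProfile _ (overlapProfile a b p z X) := by
  intro i
  induction i using Fin.lastCases with
  | last => rwa [overlapProfile_last]
  | cast i =>
    simp only [overlapProfile, Fin.snoc_castSucc]
    induction i using Fin.addCases with
    | right i => simp
    | left i =>
      induction i using Fin.addCases with
      | right i => simp
      | left i => induction i using Fin.addCases <;> simp [-Fin.natAdd_eq_addNat]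

theorem sum_overlapProfile {P : Type*} [DecidableEq P] (a b p : P) (z : ℕ) (X : Finset P)
    (g : Finset P → ℝ) :
    ∑ i, g (overlapProfile a b p z X i) =
      (z + 2) * g {a, b} + (z + 2) * g {b, p} + (z + 2) * g {a} + z * g {p} + g X := by
  simp [overlapProfile, Fin.sum_univ_castSucc, Fin.sum_univ_add, -Fin.natAdd_eq_addNat]

/-- If the tie between `b` and `a` is broken towards `b`, then the last voter of
`overlapProfile a b p z {p}` is unrepresented but becomes represented by reporting `{a}`. -/
theorem overlapProfile_manipulable {P : Type*} [DecidableEq P] {w : ℕ → ℝ} {tbp : P → P → Prop}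
    [IsStrictTotalOrder P tbp] {a b p : P} (hab : a ≠ b) (hap : a ≠ p) (hbp : b ≠ p)
    (hall : ∀ y, y = a ∨ y = b ∨ y = p) (htb : tbp b a) {j z : ℕ}
    (hone : ∀ t < j, w t = 1) (hw0 : w 0 = 1) (hj : w j < 1) (hz : 2 < z * (1 - w j))
    {f : (Fin ((z + 2) + (z + 2) + (z + 2) + z + 1) → Finset P) → Multiset P}
    (hf : IsSeqThieleRule w tbp _ (j + 1) f) :
    seats (f (overlapProfile a b p z {p})) {p} = 0 ∧
      0 < seats (f (overlapProfile a b p z {a})) {p} := by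
  have htrue : f (overlapProfile a b p z {p}) = a ::ₘ Multiset.replicate j b := by
    refine hf.eq_cons_replicate (validProfile_overlapProfile a b p z (by simp)) b a ?_ ?_
    · intro t ht y hy
      have := hone t ht
      simp only [sum_overlapProfile]
      rcases hall y with rfl | rfl | rfl
      · right
        refine ⟨?_, htb⟩
        simp [marginalGain, seats_replicate, hy, hy.symm, hap, hbp, hw0, this]
      · exact absurd rfl hy
      · left
        simp [marginalGain, seats_replicate, hab.symm, hap.symm, hbp, hbp.symm, hw0, this]
        linarith
    · intro y hy
      simp only [sum_overlapProfile]
      rcases hall y with rfl | rfl | rfl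
      · exact absurd rfl hy
      · simp [marginalGain, seats_replicate, hab, hab.symm, hap, hbp, hw0]
        nlinarith
      · simp [marginalGain, seats_replicate, hab, hab.symm, hap, hap.symm, hbp, hbp.symm, hw0]
        nlinarith
  have hlie : f (overlapProfile a b p z {a}) = p ::ₘ Multiset.replicate j a := by
    refine hf.eq_cons_replicate (validProfile_overlapProfile a b p z (by simp)) a p ?_ ?_
    · intro t ht y hy
      left
      have := hone t ht
      simp only [sum_overlapProfile]
      rcases hall y with rfl | rfl | rfl
      · exact absurd rfl hy
      all_goals
        simp [marginalGain, seats_replicate, hab, hab.symm, hap, hap.symm, hbp, hbp.symm, hw0, this]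
      linarith
    · intro y hy
      simp only [sum_overlapProfile]
      rcases hall y with rfl | rfl | rfl
      · simp [marginalGain, seats_replicate, hab, hap, hap.symm, hbp.symm, hw0]
        nlinarith
      · simp [marginalGain, seats_replicate, hab, hab.symm, hap, hap.symm, hbp, hbp.symm, hw0]
        nlinarith
      · exact absurd rfl hy
  rw [htrue, hlie]
  constructor
  · simp [seats_cons, seats_replicate, hap, hbp]
  · simp [seats_cons]

/-- Let `w` be a non-increasing sequence of nonnegative reals with
`w 0 = 1` such that `w j < 1` for some `j` (so the sequential `w`-Thiele rule is not
approval voting), and fix linear tie-breaking orders on parties. Then there exist a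
committee size `k`, a number of parties `m`, and a number of voters `n` such that the
sequential `w`-Thiele rule fails strategyproofness for unrepresented voters:
there are profiles `A, A'` and a voter `i` with `A j = A' j` for `j ≠ i`,
`f(A, A_i) = 0` and `f(A', A_i) > 0`. -/
theorem seqThiele_not_av_fails_SPUnrepresented
    (w : ℕ → ℝ) (hw0 : w 0 = 1)
    (hmono : ∀ i j : ℕ, i ≤ j → w j ≤ w i) (hnonneg : ∀ j : ℕ, 0 ≤ w j)
    (hnotAV : ∃ j : ℕ, w j < 1)
    (tbp : ∀ m : ℕ, Fin m → Fin m → Prop)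
    (htbp : ∀ m : ℕ, IsStrictTotalOrder (Fin m) (tbp m)) :
    ∃ (n m k : ℕ) (f : (Fin n → Finset (Fin m)) → Multiset (Fin m)),
      IsSeqThieleRule w (tbp m) n k f ∧
      ∃ (A A' : Fin n → Finset (Fin m)) (i : Fin n),
        ValidProfile n A ∧ ValidProfile n A' ∧ (∀ j, j ≠ i → A j = A' j) ∧
        seats (f A) (A i) = 0 ∧ 0 < seats (f A') (A i) := by
  classical
  have hjlt : w (Nat.find hnotAV) < 1 := Nat.find_spec hnotAV
  have hone : ∀ t < Nat.find hnotAV, w t = 1 := fun t ht =>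
    le_antisymm (hw0 ▸ hmono 0 t t.zero_le) (not_lt.mp (Nat.find_min hnotAV ht))
  generalize Nat.find hnotAV = j at hjlt hone
  obtain ⟨z, hz⟩ := exists_nat_gt (2 / (1 - w j))
  rw [div_lt_iff₀ (by linarith)] at hz
  have := htbp 3
  obtain ⟨a, b, hab, ha, hb, hall, htb⟩ : ∃ a b : Fin 3, a ≠ b ∧ a ≠ 2 ∧ b ≠ 2 ∧
      (∀ y, y = a ∨ y = b ∨ y = 2) ∧ tbp 3 b a := by
    rcases trichotomous_of (tbp 3) 0 1 with h | h | h
    · exact ⟨1, 0, by decide, by decide, by decide, by decide, h⟩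
    · exact absurd h (by decide)
    · exact ⟨0, 1, by decide, by decide, by decide, by decide, h⟩
  obtain ⟨f, hf⟩ := exists_isSeqThieleRule w (tbp 3) ((z + 2) + (z + 2) + (z + 2) + z + 1) (j + 1)
  refine ⟨_, 3, j + 1, f, hf, overlapProfile a b 2 z {2}, overlapProfile a b 2 z {a}, Fin.last _,
    validProfile_overlapProfile a b 2 z (by simp), validProfile_overlapProfile a b 2 z (by simp),
    overlapProfile_eq_of_ne_last a b 2 z _ _, ?_⟩
  rw [overlapProfile_last]
  exact overlapProfile_manipulable hab ha hb hall htb hone hw0 hjlt hz hf
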